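/- Let u : ℝ^d → ℝ^d be smooth and let g : ℝ^d → ℝ be smooth with 𝓔u(x) = g(x) (e₁ ⊗ e₁) for every x ∈ ℝ^d, where e₁ is the first standard basis vector (note e₁ ⊗ e₁ = e₁ ⊙ e₁). Then there exist smooth functions h, p₂, …, p_d : ℝ → ℝ such that g(x) = h(x₁) + p₂(x₁) x₂ + ⋯ + p_d(x₁) x_d for all x ∈ ℝ^d. -/

import Mathlib

/-- The symmetrized gradient `𝓔u(x) = ½(Du(x) + Du(x)ᵀ)`. -/
noncomputable def symGrad {d : ℕ} (u : (Fin d → ℝ) → (Fin d → ℝ)) (x : Fin d → ℝ) :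
    Matrix (Fin d) (Fin d) ℝ :=
  fun i j => (fderiv ℝ u x (Pi.single j 1) i + fderiv ℝ u x (Pi.single i 1) j) / 2

/-- The partial derivative of `f` in the `i`-th coordinate direction. -/
noncomputable def partialDeriv {n : ℕ} (i : Fin n) (f : (Fin n → ℝ) → ℝ) (x : Fin n → ℝ) : ℝ :=
  fderiv ℝ f x (Pi.single i 1)

theorem ContDiff.partialDeriv {n : ℕ} {f : (Fin n → ℝ) → ℝ} (hf : ContDiff ℝ (⊤ : ℕ∞) f)
    (i : Fin n) : ContDiff ℝ (⊤ : ℕ∞) (partialDeriv i f) :=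
  (hf.fderiv_right (m := (⊤ : ℕ∞)) le_rfl).clm_apply contDiff_const

theorem partialDeriv_comm {n : ℕ} {f : (Fin n → ℝ) → ℝ} (hf : ContDiff ℝ (⊤ : ℕ∞) f)
    (i j : Fin n) :
    partialDeriv i (partialDeriv j f) = partialDeriv j (partialDeriv i f) := by
  ext x
  have hd : DifferentiableAt ℝ (fderiv ℝ f) x :=
    (hf.fderiv_right (m := (⊤ : ℕ∞)) le_rfl).differentiable (by simp) x
  have key : ∀ a b : Fin n, partialDeriv a (partialDeriv b f) x
      = fderiv ℝ (fderiv ℝ f) x (Pi.single a 1) (Pi.single b 1) := by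
    intro a b
    change fderiv ℝ (fun y => fderiv ℝ f y (Pi.single b 1)) x _ = _
    rw [fderiv_clm_apply hd (differentiableAt_const _)]
    simp
  rw [key, key]
  exact (hf.contDiffAt.isSymmSndFDerivAt (by
    simpa using WithTop.coe_le_coe.2 (le_top : (2 : ℕ∞) ≤ ⊤))) _ _

theorem partialDeriv_neg {n : ℕ} (f : (Fin n → ℝ) → ℝ) (i : Fin n) :
    partialDeriv i (-f) = -partialDeriv i f := by
  ext x
  simp [partialDeriv, fderiv_neg]

theorem fderiv_apply_eq_sum_partialDeriv {n : ℕ} (f : (Fin n → ℝ) → ℝ) (x v : Fin n → ℝ) :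
    fderiv ℝ f x v = ∑ i, v i * partialDeriv i f x := by
  conv_lhs => rw [pi_eq_sum_univ' v]
  simp [partialDeriv, map_sum]

/-- A smooth function whose second derivative in the direction `v` vanishes is affine along `v`. -/
theorem eq_add_fderiv_of_fderiv_fderiv_eq_zero {E : Type*} [NormedAddCommGroup E]
    [NormedSpace ℝ E] {f : E → ℝ} {v : E} (hf : Differentiable ℝ f)
    (hf' : Differentiable ℝ fun y => fderiv ℝ f y v)
    (h : ∀ y, fderiv ℝ (fun z => fderiv ℝ f z v) y v = 0) (x : E) :
    f (x + v) = f x + fderiv ℝ f x v := by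
  have line : ∀ s : ℝ, HasDerivAt (fun s : ℝ => x + s • v) v s := fun s => by
    simpa using ((hasDerivAt_id s).smul_const v).const_add x
  have comp : ∀ {F : E → ℝ}, Differentiable ℝ F → ∀ s : ℝ,
      HasDerivAt (fun s : ℝ => F (x + s • v)) (fderiv ℝ F (x + s • v) v) s := fun hF s =>
    (hF _).hasFDerivAt.comp_hasDerivAt s (line s)
  have slope : ∀ s : ℝ, fderiv ℝ f (x + s • v) v = fderiv ℝ f x v := fun s => by
    simpa using is_const_of_deriv_eq_zero (fun s => (comp hf' s).differentiableAt)
      (fun s => (comp hf' s).deriv.trans (h _)) s 0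
  have affine : ∀ s : ℝ,
      HasDerivAt (fun s : ℝ => f (x + s • v) - s * fderiv ℝ f x v) 0 s := fun s => by
    simpa [slope s] using (comp hf s).fun_sub ((hasDerivAt_id' s).mul_const (fderiv ℝ f x v))
  have := is_const_of_deriv_eq_zero (fun s => (affine s).differentiableAt)
    (fun s => (affine s).deriv) 1 0
  simp only [one_smul, one_mul, zero_smul, add_zero, zero_mul, sub_zero] at this
  linarith

theorem partialDeriv_partialDeriv_eq_zero_of_symGrad {d : ℕ}
    {u : (Fin (d + 1) → ℝ) → (Fin (d + 1) → ℝ)} {g : (Fin (d + 1) → ℝ) → ℝ}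
    (hu : ContDiff ℝ (⊤ : ℕ∞) u)
    (heq : ∀ x, symGrad u x = g x • Matrix.vecMulVec (Pi.single 0 1) (Pi.single 0 1))
    {j k : Fin (d + 1)} (hj : j ≠ 0) (hk : k ≠ 0) :
    partialDeriv j (partialDeriv k g) = 0 := by
  set w : Fin (d + 1) → (Fin (d + 1) → ℝ) → ℝ := fun i x => u x i
  have hw : ∀ i, ContDiff ℝ (⊤ : ℕ∞) (w i) := fun i => contDiff_pi.1 hu i
  have entry : ∀ i l x, (partialDeriv l (w i) x + partialDeriv i (w l) x) / 2
      = g x * ((Pi.single 0 1 : Fin (d + 1) → ℝ) i * (Pi.single 0 1 : Fin (d + 1) → ℝ) l) := by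
    intro i l x
    have hd : DifferentiableAt ℝ u x := hu.differentiable (by simp) x
    have hcoord : ∀ a b, partialDeriv b (w a) x = fderiv ℝ u x (Pi.single b 1) a := fun a b => by
      simp only [partialDeriv, w, fderiv_apply hd]
      rfl
    rw [hcoord, hcoord]
    simpa [symGrad, Matrix.vecMulVec_apply] using congrFun (congrFun (heq x) i) l
  have hg : g = partialDeriv 0 (w 0) := by
    ext x
    have := entry 0 0 x
    simp only [Pi.single_eq_same] at this
    linarith
  have skew : ∀ a b, b ≠ 0 → partialDeriv a (w b) = -partialDeriv b (w a) := by
    intro a b hb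
    ext x
    have := entry a b x
    simp only [Pi.single_eq_of_ne hb, mul_zero] at this
    simp only [Pi.neg_apply]
    linarith
  have reduce : ∀ a b, b ≠ 0 → partialDeriv a (partialDeriv b g)
      = -partialDeriv 0 (partialDeriv 0 (partialDeriv a (w b))) := by
    intro a b hb
    have hb0 : partialDeriv b (w 0) = -partialDeriv 0 (w b) := by
      rw [skew 0 b hb, neg_neg]
    rw [hg, partialDeriv_comm (hw 0), hb0, partialDeriv_neg, partialDeriv_neg,
      partialDeriv_comm ((hw b).partialDeriv 0), partialDeriv_comm (hw b) a]
  have h₁ := reduce j k hk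
  have h₂ := reduce k j hj
  rw [skew k j hj, partialDeriv_neg, partialDeriv_neg, neg_neg] at h₂
  have hgs : ContDiff ℝ (⊤ : ℕ∞) g := hg ▸ (hw 0).partialDeriv 0
  rw [partialDeriv_comm hgs k j] at h₂
  ext x
  have e₁ := congrFun h₁ x
  have e₂ := congrFun h₂ x
  simp only [Pi.neg_apply, Pi.zero_apply] at *
  linarith

/-- (`d + 1` plays the role of the dimension `d ≥ 1`.) If `u : ℝ^d → ℝ^d` and
`g : ℝ^d → ℝ` are smooth with `𝓔u(x) = g(x)(e₁ ⊗ e₁)` everywhere, then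
`g(x) = h(x₁) + p₂(x₁)x₂ + ⋯ + p_d(x₁)x_d` for smooth functions `h, p₂, …, p_d : ℝ → ℝ`. -/
theorem symGrad_e1e1_structure {d : ℕ}
    (u : (Fin (d + 1) → ℝ) → (Fin (d + 1) → ℝ)) (g : (Fin (d + 1) → ℝ) → ℝ)
    (hu : ContDiff ℝ (⊤ : ℕ∞) u) (hg : ContDiff ℝ (⊤ : ℕ∞) g)
    (heq : ∀ x, symGrad u x = g x • Matrix.vecMulVec (Pi.single 0 1) (Pi.single 0 1)) :
    ∃ (h : ℝ → ℝ) (p : Fin (d + 1) → ℝ → ℝ),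
      ContDiff ℝ (⊤ : ℕ∞) h ∧ (∀ i, ContDiff ℝ (⊤ : ℕ∞) (p i)) ∧
      ∀ x, g x = h (x 0) + ∑ i : Fin (d + 1), (if 1 ≤ (i : ℕ) then p i (x 0) * x i else 0) := by
  refine ⟨fun t => g (Pi.single 0 t), fun i t => partialDeriv i g (Pi.single 0 t),
    ?_, fun i => ?_, fun x => ?_⟩
  · exact hg.comp (ContinuousLinearMap.single ℝ (fun _ : Fin (d + 1) => ℝ) 0).contDiff
  · exact (hg.partialDeriv i).comp
      (ContinuousLinearMap.single ℝ (fun _ : Fin (d + 1) => ℝ) 0).contDiff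
  set v : Fin (d + 1) → ℝ := x - Pi.single 0 (x 0) with hv
  have hv0 : v 0 = 0 := by simp [hv]
  have hvi : ∀ i, i ≠ 0 → v i = x i := fun i hi => by simp [hv, hi]
  have hfd : (fun y => fderiv ℝ g y v) = fun y => ∑ i, v i * partialDeriv i g y :=
    funext fun y => fderiv_apply_eq_sum_partialDeriv g y v
  have hdiff : ∀ i, Differentiable ℝ (partialDeriv i g) := fun i =>
    (hg.partialDeriv i).differentiable (by simp)
  have hsecond : ∀ y, fderiv ℝ (fun z => fderiv ℝ g z v) y v = 0 := by
    intro y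
    rw [hfd, fderiv_fun_sum fun i _ => ((hdiff i) y).const_mul (v i),
      _root_.sum_apply]
    refine Finset.sum_eq_zero fun i _ => ?_
    rw [fderiv_const_mul ((hdiff i) y), _root_.smul_apply,
      fderiv_apply_eq_sum_partialDeriv, smul_eq_mul, Finset.mul_sum]
    refine Finset.sum_eq_zero fun j _ => ?_
    by_cases hi : i = 0
    · simp [hi, hv0]
    by_cases hj : j = 0
    · simp [hj, hv0]
    simp [partialDeriv_partialDeriv_eq_zero_of_symGrad hu heq hj hi]
  have haff := eq_add_fderiv_of_fderiv_fderiv_eq_zero (hg.differentiable (by simp))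
    (by rw [hfd]; fun_prop) hsecond (Pi.single 0 (x 0))
  rw [fderiv_apply_eq_sum_partialDeriv, hv, add_sub_cancel, ← hv] at haff
  rw [haff]
  congr 1
  refine Finset.sum_congr rfl fun i _ => ?_
  by_cases hi : i = 0
  · simp [hi, hv0]
  · rw [if_pos (Nat.one_le_iff_ne_zero.2 (Fin.val_ne_zero_iff.2 hi)), hvi i hi, mul_comm]
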